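/- Let n be a degree statistic, let 𝒯_n be uniformly random in 𝕋_n, and let T be a plane rooted tree with degree statistic n_T. Then E[N_{n_T}(𝒯_n)] = |𝕋_{n_T}| · E[N_T(𝒯_n)], and Var(N_{n_T}(𝒯_n)) = |𝕋_{n_T}|² · (Var(N_T(𝒯_n)) − E[N_T(𝒯_n)]) + |𝕋_{n_T}| · E[N_T(𝒯_n)]. -/

import Mathlib

/-!
Common definitions: plane rooted trees, fringe subtree counts, random trees with
a given degree statistic, Poisson/normal limit notions, conditioned Galton–Watson
trees, and sampling without replacement.
-/

open Filter MeasureTheory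
open scoped Topology Classical

/-- A plane rooted tree: a root together with a linearly ordered (possibly empty)
list of subtrees. Structural equality coincides with isomorphism of plane rooted trees. -/
inductive PlaneTree : Type
  | node : List PlaneTree → PlaneTree

namespace PlaneTree

/-- The (out)degree of the root: its number of children. -/
def degree : PlaneTree → ℕ
  | node ts => ts.length

mutual
  /-- The list of all fringe subtrees of a tree (one for each vertex). -/
  def fringe : PlaneTree → List PlaneTree
    | node ts => node ts :: fringeList ts
  def fringeList : List PlaneTree → List PlaneTree
    | [] => []
    | t :: ts => fringe t ++ fringeList ts
end

/-- The number of vertices `|T|` of a plane tree. -/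
def size (T : PlaneTree) : ℕ := T.fringe.length

/-- The degree statistic `n_T` of a tree: `n_T(i)` is the number of vertices with `i` children. -/
noncomputable def degStat (T : PlaneTree) : ℕ →₀ ℕ :=
  Multiset.toFinsupp ((T.fringe.map degree : List ℕ) : Multiset ℕ)

/-- `N_{T'}(T)`: the number of fringe subtrees of `T` equal to `T'`. -/
noncomputable def countTree (T' T : PlaneTree) : ℕ :=
  (T.fringe.filter fun t => decide (t = T')).length

/-- `N_m(T)` for a degree statistic `m`: the number of fringe subtrees of `T`
with degree statistic `m`. -/
noncomputable def countStat (m : ℕ →₀ ℕ) (T : PlaneTree) : ℕ :=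
  (T.fringe.filter fun t => decide (degStat t = m)).length

/-- `N_m(T)` for an integer `m`: the number of fringe subtrees of `T` of size `m`. -/
noncomputable def countSize (m : ℕ) (T : PlaneTree) : ℕ :=
  (T.fringe.filter fun t => decide (size t = m)).length

end PlaneTree

/-- `n : ℕ →₀ ℕ` is a degree statistic: `∑ n(i) = 1 + ∑ i·n(i)`. -/
def IsDegStat (n : ℕ →₀ ℕ) : Prop :=
  (n.sum fun _ c => c) = 1 + n.sum fun i c => i * c

/-- `|n| = ∑_i n(i)`, the size of a degree statistic. -/
def nsize (n : ℕ →₀ ℕ) : ℕ := n.sum fun _ c => c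

/-- The set `𝕋_n` of plane trees with degree statistic `n`. -/
def treesWith (n : ℕ →₀ ℕ) : Set PlaneTree := {T | PlaneTree.degStat T = n}

/-- `|𝕋_n|`, the number of plane trees with degree statistic `n`. -/
noncomputable def numTrees (n : ℕ →₀ ℕ) : ℕ := (treesWith n).ncard

/-- The probability that a uniformly random tree `𝒯_n ∈ 𝕋_n` satisfies `P`. -/
noncomputable def prob (n : ℕ →₀ ℕ) (P : PlaneTree → Prop) : ℝ :=
  (({T ∈ treesWith n | P T}).ncard : ℝ) / (numTrees n : ℝ)

/-- The expectation `E[f(𝒯_n)]` of an `ℕ`-valued functional of the uniformly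
random tree `𝒯_n ∈ 𝕋_n`. -/
noncomputable def expect (n : ℕ →₀ ℕ) (f : PlaneTree → ℕ) : ℝ :=
  ∑' k : ℕ, (k : ℝ) * prob n (fun T => f T = k)

/-- The variance `Var[f(𝒯_n)]`. -/
noncomputable def variance (n : ℕ →₀ ℕ) (f : PlaneTree → ℕ) : ℝ :=
  expect n (fun T => (f T) ^ 2) - (expect n f) ^ 2

/-- The empirical degree distribution `p_i(n) = n(i)/|n|`. -/
noncomputable def empDist (n : ℕ →₀ ℕ) (i : ℕ) : ℝ := (n i : ℝ) / (nsize n : ℝ)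

/-- `π_p(T) = ∏_{i ≥ 0} p_i^{n_T(i)}`. -/
noncomputable def piDist (p : ℕ → ℝ) (T : PlaneTree) : ℝ :=
  (PlaneTree.degStat T).prod fun i c => p i ^ c

/-- `π_p(𝕋_m) = |𝕋_m| · ∏_{i ≥ 0} p_i^{m(i)}`. -/
noncomputable def piSet (p : ℕ → ℝ) (m : ℕ →₀ ℕ) : ℝ :=
  (numTrees m : ℝ) * m.prod fun i c => p i ^ c

/-- Condition 1: the `nseq κ` are degree statistics with `|n_κ| → ∞` and
`p_i(n_κ) → p_i` for every `i`, where `p` is a probability distribution on `ℕ`. -/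
def Condition1 (nseq : ℕ → (ℕ →₀ ℕ)) (p : ℕ → ℝ) : Prop :=
  (∀ κ, IsDegStat (nseq κ)) ∧
  Tendsto (fun κ => nsize (nseq κ)) atTop atTop ∧
  (∀ i, 0 ≤ p i) ∧ HasSum p 1 ∧
  (∀ i, Tendsto (fun κ => empDist (nseq κ) i) atTop (𝓝 (p i)))

/-- Condition 2: in addition, `∑ i² p_i(n_κ) → ∑ i² p_i < ∞`. -/
def Condition2 (nseq : ℕ → (ℕ →₀ ℕ)) (p : ℕ → ℝ) : Prop :=
  Summable (fun i : ℕ => (i : ℝ) ^ 2 * p i) ∧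
  Tendsto (fun κ => ∑' i : ℕ, (i : ℝ) ^ 2 * empDist (nseq κ) i) atTop
    (𝓝 (∑' i : ℕ, (i : ℝ) ^ 2 * p i))

/-- `σ_p² = ∑_{i ≥ 0} (i-1)² p_i`. -/
noncomputable def sigmaSq (p : ℕ → ℝ) : ℝ := ∑' i : ℕ, ((i : ℝ) - 1) ^ 2 * p i

/-- The point probabilities of the Poisson distribution `Po(lam)`. -/
noncomputable def poissonPMF (lam : ℝ) (k : ℕ) : ℝ :=
  Real.exp (-lam) * lam ^ k / (Nat.factorial k : ℝ)

/-- The `q`-th moment of the Poisson distribution `Po(lam)`. -/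
noncomputable def poissonMoment (lam : ℝ) (q : ℕ) : ℝ :=
  ∑' k : ℕ, (k : ℝ) ^ q * poissonPMF lam k

/-- The standard normal cumulative distribution function. -/
noncomputable def stdNormalCDF (x : ℝ) : ℝ :=
  ∫ t in Set.Iic x, Real.exp (-t ^ 2 / 2) / Real.sqrt (2 * Real.pi)

/-- The total variation distance between the law of `f(𝒯_n)` and `Po(lam)`:
`sup_A |P(f(𝒯_n) ∈ A) − Po(lam)(A)|`. -/
noncomputable def dTVPoisson (n : ℕ →₀ ℕ) (f : PlaneTree → ℕ) (lam : ℝ) : ℝ :=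
  ⨆ A : Set ℕ, |prob n (fun T => f T ∈ A) - ∑' k : ℕ, A.indicator (poissonPMF lam) k|

/-- A probability distribution on `ℕ` is nonlattice: the gcd of the differences of
points of its support is `1`. -/
def Nonlattice (p : ℕ → ℝ) : Prop :=
  ∀ h : ℕ, (∀ i j : ℕ, 0 < p i → 0 < p j → (h : ℤ) ∣ (i : ℤ) - (j : ℤ)) → h = 1

/-- The partition function `P(|𝒯_p| = n)` of a Galton–Watson tree with offspring
distribution `p`. -/
noncomputable def gwZ (p : ℕ → ℝ) (n : ℕ) : ℝ :=
  ∑' T : PlaneTree, if PlaneTree.size T = n then piDist p T else 0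

/-- `P(𝒯_{p,n} ∈ {T | P T})` for the conditioned Galton–Watson tree `𝒯_{p,n}`. -/
noncomputable def probGW (p : ℕ → ℝ) (n : ℕ) (P : PlaneTree → Prop) : ℝ :=
  (∑' T : PlaneTree, if PlaneTree.size T = n ∧ P T then piDist p T else 0) / gwZ p n

/-- The expectation `E[f(𝒯_{p,n})]` for an `ℕ`-valued functional. -/
noncomputable def expectGW (p : ℕ → ℝ) (n : ℕ) (f : PlaneTree → ℕ) : ℝ :=
  ∑' k : ℕ, (k : ℝ) * probGW p n (fun T => f T = k)

/-- The filter `n → ∞` along the sizes `n` for which the conditioning `|𝒯_p| = n`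
is well defined. -/
noncomputable def gwFilter (p : ℕ → ℝ) : Filter ℕ :=
  atTop ⊓ Filter.principal {n | 0 < gwZ p n}

/-- A positive function on the positive reals is slowly varying at infinity. -/
def SlowlyVarying (L : ℝ → ℝ) : Prop :=
  (∀ x : ℝ, 0 < x → 0 < L x) ∧
  ∀ c : ℝ, 0 < c → Tendsto (fun x : ℝ => L (c * x) / L x) atTop (𝓝 1)

/-- The probability that a uniformly random permutation of `Fin n` satisfies `P`. -/
noncomputable def probPerm {n : ℕ} (P : Equiv.Perm (Fin n) → Prop) : ℝ :=
  ((Finset.univ.filter P).card : ℝ) / ((Finset.univ : Finset (Equiv.Perm (Fin n))).card : ℝ)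

/-- `S_m = ∑_{i=1}^m d_{τ(i)}`: the sum of `m` of the values `d`, drawn without
replacement via the permutation `τ`. -/
def sampleSum {n : ℕ} (d : Fin n → ℤ) (m : ℕ) (τ : Equiv.Perm (Fin n)) : ℤ :=
  ∑ i : Fin n, if (i : ℕ) < m then d (τ i) else 0

/-- The mean `d̄` of the values `d`. -/
noncomputable def dbar {n : ℕ} (d : Fin n → ℤ) : ℝ := (∑ i : Fin n, (d i : ℝ)) / n

/-- `Q = ∑_i (d_i − d̄)²`. -/
noncomputable def Qval {n : ℕ} (d : Fin n → ℤ) : ℝ := ∑ i : Fin n, ((d i : ℝ) - dbar d) ^ 2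

/-- `σ̂² = (m/n)(1 − m/n) Q`. -/
noncomputable def sigHatSq {n : ℕ} (d : Fin n → ℤ) (m : ℕ) : ℝ :=
  ((m : ℝ) / n) * (1 - (m : ℝ) / n) * Qval d

/-- The empirical frequency `p_k(d) = #{i : d_i = k}/n`. -/
noncomputable def empFreq {n : ℕ} (d : Fin n → ℤ) (k : ℤ) : ℝ :=
  ((Finset.univ.filter (fun i => d i = k)).card : ℝ) / n

/-- The characteristic function `φ_{S_m}(t) = E[exp(i t S_m)]` of the sample sum. -/
noncomputable def charFn {n : ℕ} (d : Fin n → ℤ) (m : ℕ) (t : ℝ) : ℂ :=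
  (Fintype.card (Equiv.Perm (Fin n)) : ℂ)⁻¹ *
    ∑ τ : Equiv.Perm (Fin n), Complex.exp (Complex.I * t * (sampleSum d m τ : ℂ))

/-- A probability distribution on `ℤ` is nonlattice. -/
def NonlatticeZ (p : ℤ → ℝ) : Prop :=
  ∀ h : ℕ, (∀ i j : ℤ, 0 < p i → 0 < p j → (h : ℤ) ∣ i - j) → h = 1

namespace PlaneTree

theorem fringe_node (us : List PlaneTree) : fringe (node us) = node us :: fringeList us := by
  rw [fringe]

theorem fringeList_nil : fringeList [] = [] := by
  rw [fringeList]

theorem fringeList_cons (us ts : List PlaneTree) :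
    fringeList (node us :: ts) = node us :: (fringeList us ++ fringeList ts) := by
  rw [fringeList, fringe_node, List.cons_append]

theorem fringeList_singleton (t : PlaneTree) : fringeList [t] = fringe t := by
  rw [fringeList, fringeList_nil, List.append_nil]

/-- Induction on plane forests: remove the root of the first tree. -/
theorem forest_induction {P : List PlaneTree → Prop} (nil : P [])
    (cons : ∀ us ts, P us → P ts → P (node us :: ts)) : ∀ ts, P ts
  | [] => nil
  | node us :: ts => cons us ts (forest_induction nil cons us) (forest_induction nil cons ts)

/-- The degree statistic of a plane forest. -/
noncomputable def forestStat (ts : List PlaneTree) : ℕ →₀ ℕ :=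
  Multiset.toFinsupp (((fringeList ts).map degree : List ℕ) : Multiset ℕ)

theorem forestStat_singleton (t : PlaneTree) : forestStat [t] = degStat t := by
  rw [forestStat, fringeList_singleton, degStat]

theorem degStat_node (us : List PlaneTree) :
    degStat (node us) = Finsupp.single us.length 1 + forestStat us := by
  rw [degStat, forestStat, fringe_node, List.map_cons, ← Multiset.cons_coe,
    ← Multiset.singleton_add, map_add, Multiset.toFinsupp_singleton, degree]

theorem forestStat_cons (us ts : List PlaneTree) :
    forestStat (node us :: ts) = degStat (node us) + forestStat ts := by
  rw [degStat_node, forestStat, forestStat, forestStat, fringeList_cons, List.map_cons,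
    List.map_append, ← Multiset.cons_coe, ← Multiset.coe_add, ← Multiset.singleton_add, map_add,
    map_add, Multiset.toFinsupp_singleton, degree, add_assoc]

theorem nsize_add (p q : ℕ →₀ ℕ) : nsize (p + q) = nsize p + nsize q :=
  Finsupp.sum_add_index' (fun _ => rfl) fun _ _ _ => rfl

theorem nsize_degStat_node (us : List PlaneTree) :
    nsize (degStat (node us)) = 1 + nsize (forestStat us) := by
  rw [degStat_node, nsize_add, nsize, Finsupp.sum_single_index rfl]

theorem nsize_le_of_mem_fringeList {t : PlaneTree} (ts : List PlaneTree) :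
    t ∈ fringeList ts → nsize (degStat t) ≤ nsize (forestStat ts) := by
  induction ts using forest_induction with
  | nil => simp [fringeList_nil]
  | cons us ts ihu iht =>
    rw [fringeList_cons, forestStat_cons, nsize_add, List.mem_cons, List.mem_append]
    rintro (rfl | h | h)
    · omega
    · have := ihu h
      have := nsize_degStat_node us
      omega
    · have := iht h
      omega

/-- The plane forests obtained by at most `k` nested applications of the decomposition of a
nonempty forest into the children of its first root and the remaining trees. -/
noncomputable def forests : ℕ → Finset (List PlaneTree)
  | 0 => {[]}
  | k + 1 => insert [] ((forests k ×ˢ forests k).image fun p => node p.1 :: p.2)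

theorem mem_forests (ts : List PlaneTree) : ∀ k, nsize (forestStat ts) ≤ k → ts ∈ forests k := by
  induction ts using forest_induction with
  | nil => rintro (_ | k) - <;> simp [forests]
  | cons us ts ihu iht =>
    intro k hk
    rw [forestStat_cons, nsize_add, nsize_degStat_node] at hk
    obtain _ | k := k
    · omega
    · exact Finset.mem_insert_of_mem (Finset.mem_image.2
        ⟨(us, ts), Finset.mem_product.2 ⟨ihu k (by omega), iht k (by omega)⟩, rfl⟩)

theorem sum_forests_succ {R : Type*} [AddCommMonoid R] (k : ℕ) (F : List PlaneTree → R) :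
    ∑ ts ∈ forests (k + 1), F ts =
      F [] + ∑ us ∈ forests k, ∑ ts ∈ forests k, F (node us :: ts) := by
  rw [forests, Finset.sum_insert (by simp), Finset.sum_image, Finset.sum_product]
  rintro ⟨u, t⟩ - ⟨u', t'⟩ - h
  simpa using h

theorem treesWith_finite (n : ℕ →₀ ℕ) : (treesWith n).Finite := by
  refine Set.Finite.of_finite_image (f := fun t => [t])
    ((forests (nsize n)).finite_toSet.subset ?_) (fun _ _ _ _ h => by simpa using h)
  rintro _ ⟨t, ht, rfl⟩
  refine mem_forests _ _ (le_of_eq ?_)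
  rw [forestStat_singleton, show degStat t = n from ht]

/-- The finite set of plane trees with a given degree statistic. -/
noncomputable def treesFinset (n : ℕ →₀ ℕ) : Finset PlaneTree := (treesWith_finite n).toFinset

theorem mem_treesFinset {n : ℕ →₀ ℕ} {t : PlaneTree} : t ∈ treesFinset n ↔ degStat t = n := by
  simp [treesFinset, treesWith]

theorem numTrees_eq_card (n : ℕ →₀ ℕ) : numTrees n = (treesFinset n).card :=
  Set.ncard_eq_toFinset_card _ (treesWith_finite n)

section Weights

variable {R : Type*} [CommRing R]

/-- The product of a weight over all fringe trees of a plane forest. -/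
def forestWeight (w : PlaneTree → R) (ts : List PlaneTree) : R := ((fringeList ts).map w).prod

theorem forestWeight_cons (w : PlaneTree → R) (us ts : List PlaneTree) :
    forestWeight w (node us :: ts) = w (node us) * forestWeight w us * forestWeight w ts := by
  simp [forestWeight, fringeList_cons, mul_assoc]

theorem forestWeight_eq_one {w : PlaneTree → R} {m : ℕ →₀ ℕ}
    (hw : ∀ t, degStat t ≠ m → w t = 1) {us : List PlaneTree} (hus : degStat (node us) = m) :
    forestWeight w us = 1 := by
  refine List.prod_eq_one fun x hx => ?_
  obtain ⟨t, ht, rfl⟩ := List.mem_map.1 hx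
  refine hw t fun h => ?_
  have h1 := nsize_le_of_mem_fringeList us ht
  have h2 := nsize_degStat_node us
  rw [h, ← hus] at h1
  omega

theorem sum_forests_of_degStat_eq (w : PlaneTree → R) {m : ℕ →₀ ℕ} {k : ℕ} (hk : nsize m ≤ k + 1) :
    ∑ us ∈ forests k with degStat (node us) = m, w (node us) = ∑ t ∈ treesFinset m, w t := by
  refine Finset.sum_bij (fun us _ => node us) ?_ ?_ ?_ (fun _ _ => rfl)
  · intro us hus
    exact mem_treesFinset.2 (Finset.mem_filter.1 hus).2
  · intro us _ us' _ h
    simpa using h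
  · rintro ⟨us⟩ ht
    rw [mem_treesFinset] at ht
    refine ⟨us, Finset.mem_filter.2 ⟨mem_forests us k ?_, ht⟩, rfl⟩
    have := nsize_degStat_node us
    rw [ht] at this
    omega

/-- If two weights are trivial away from the trees with degree statistic `m`, and have the same
total on those trees, then the weighted counts of forests with respect to them agree. -/
theorem sum_forestWeight_congr {w w' : PlaneTree → R} {m : ℕ →₀ ℕ}
    (hw : ∀ t, degStat t ≠ m → w t = 1) (hw' : ∀ t, degStat t ≠ m → w' t = 1)
    (hsum : ∑ t ∈ treesFinset m, w t = ∑ t ∈ treesFinset m, w' t) (k : ℕ) :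
    ∀ g : ℕ → (ℕ →₀ ℕ) → R, (∀ l p, k < nsize p → g l p = 0) →
      ∑ ts ∈ forests k, forestWeight w ts * g ts.length (forestStat ts) =
        ∑ ts ∈ forests k, forestWeight w' ts * g ts.length (forestStat ts) := by
  induction k with
  | zero => intro g _; simp [forests, forestWeight, fringeList_nil]
  | succ k ih =>
    intro g hg
    rw [sum_forests_succ, sum_forests_succ]
    congr 1
    let G : (ℕ →₀ ℕ) → R := fun p =>
      ∑ ts ∈ forests k, forestWeight w ts * g (ts.length + 1) (p + forestStat ts)
    have hG : ∀ p, k + 1 < nsize p → G p = 0 := fun p hp =>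
      Finset.sum_eq_zero fun ts _ => by rw [hg _ _ (by rw [nsize_add]; omega), mul_zero]
    have hG' : ∀ us, ∑ ts ∈ forests k,
        forestWeight w' ts * g (ts.length + 1) (degStat (node us) + forestStat ts) =
          G (degStat (node us)) := fun us =>
      (ih (fun l p => g (l + 1) (degStat (node us) + p)) fun l p hp =>
        hg _ _ (by rw [nsize_add, nsize_degStat_node]; omega)).symm
    have key : ∀ v : PlaneTree → R, (∀ t, degStat t ≠ m → v t = 1) →
        ∑ us ∈ forests k, v (node us) * forestWeight v us * G (degStat (node us)) =
          (∑ t ∈ treesFinset m, v t) * G m +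
            ∑ us ∈ forests k, forestWeight v us *
              (if Finsupp.single us.length 1 + forestStat us = m then 0
                else G (Finsupp.single us.length 1 + forestStat us)) := by
      intro v hv
      have h1 : (∑ t ∈ treesFinset m, v t) * G m =
          ∑ us ∈ forests k, if degStat (node us) = m then v (node us) * G m else 0 := by
        by_cases hm : nsize m ≤ k + 1
        · rw [← sum_forests_of_degStat_eq v hm, Finset.sum_mul, Finset.sum_filter]
        · simp [hG m (by omega)]
      rw [h1, ← Finset.sum_add_distrib]
      refine Finset.sum_congr rfl fun us _ => ?_
      rw [← degStat_node]
      split_ifs with h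
      · rw [forestWeight_eq_one hv h, h]; ring
      · rw [hv _ h]; ring
    have expand : ∀ v : PlaneTree → R, (∀ us, ∑ ts ∈ forests k,
        forestWeight v ts * g (ts.length + 1) (degStat (node us) + forestStat ts) =
          G (degStat (node us))) →
        ∑ us ∈ forests k, ∑ ts ∈ forests k, forestWeight v (node us :: ts) *
          g (node us :: ts).length (forestStat (node us :: ts)) =
        ∑ us ∈ forests k, v (node us) * forestWeight v us * G (degStat (node us)) := by
      intro v hv
      refine Finset.sum_congr rfl fun us _ => ?_
      rw [← hv us, Finset.mul_sum]
      refine Finset.sum_congr rfl fun ts _ => ?_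
      rw [forestWeight_cons, forestStat_cons, List.length_cons, mul_assoc]
    rw [expand w fun _ => rfl, expand w' hG', key w hw, key w' hw', hsum]
    congr 1
    refine ih (fun l p => if Finsupp.single l 1 + p = m then 0 else G (Finsupp.single l 1 + p))
      fun l p hp => ?_
    rw [hG _ (by rw [nsize_add, nsize, Finsupp.sum_single_index rfl]; omega), ite_self]

theorem sum_treesFinset_eq_sum_forests (w : PlaneTree → R) (n : ℕ →₀ ℕ) :
    ∑ t ∈ treesFinset n, (t.fringe.map w).prod =
      ∑ ts ∈ forests (nsize n), forestWeight w ts *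
        (if ts.length = 1 ∧ forestStat ts = n then 1 else 0) := by
  simp only [mul_ite, mul_one, mul_zero]
  rw [← Finset.sum_filter]
  refine Finset.sum_bij (fun t _ => [t]) ?_ ?_ ?_ ?_
  · intro t ht
    rw [mem_treesFinset, ← forestStat_singleton] at ht
    exact Finset.mem_filter.2 ⟨mem_forests _ _ (by rw [ht]), rfl, ht⟩
  · intro t _ t' _ h
    simpa using h
  · intro ts hts
    obtain ⟨-, hl, hs⟩ := Finset.mem_filter.1 hts
    obtain ⟨t, rfl⟩ := List.length_eq_one_iff.1 hl
    exact ⟨t, mem_treesFinset.2 (by rw [← forestStat_singleton, hs]), rfl⟩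
  · intro t _
    rw [forestWeight, fringeList_singleton]

theorem sum_treesFinset_congr {w w' : PlaneTree → R} {m : ℕ →₀ ℕ}
    (hw : ∀ t, degStat t ≠ m → w t = 1) (hw' : ∀ t, degStat t ≠ m → w' t = 1)
    (hsum : ∑ t ∈ treesFinset m, w t = ∑ t ∈ treesFinset m, w' t) (n : ℕ →₀ ℕ) :
    ∑ t ∈ treesFinset n, (t.fringe.map w).prod = ∑ t ∈ treesFinset n, (t.fringe.map w').prod := by
  rw [sum_treesFinset_eq_sum_forests, sum_treesFinset_eq_sum_forests]
  refine sum_forestWeight_congr hw hw' hsum _ (fun l p => if l = 1 ∧ p = n then 1 else 0) ?_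
  rintro l p hp
  exact if_neg fun h => by simp [h.2] at hp

end Weights

theorem prod_map_ite {α R : Type*} [CommMonoid R] (P : α → Prop)
    [DecidablePred P] (x : R) (l : List α) :
    (l.map fun t => if P t then x else 1).prod = x ^ (l.filter fun t => decide (P t)).length := by
  induction l with
  | nil => simp
  | cons a l ih =>
    by_cases h : P a <;> simp [h, ih, pow_succ']

open Polynomial in
/-- The generating functions of `N_{n_T}` and of `N_T` over `𝕋_n` agree up to a rescaling of
the variable centred at `1`. -/
theorem sum_pow_countStat (n : ℕ →₀ ℕ) (T : PlaneTree) :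
    ∑ t ∈ treesFinset n, (1 + X : ℝ[X]) ^ countStat (degStat T) t =
      ∑ t ∈ treesFinset n, (1 + C (numTrees (degStat T) : ℝ) * X) ^ countTree T t := by
  simp only [countStat, countTree, ← prod_map_ite]
  refine sum_treesFinset_congr
    (w := fun t => if degStat t = degStat T then (1 + X : ℝ[X]) else 1)
    (w' := fun t => if t = T then 1 + C (numTrees (degStat T) : ℝ) * X else 1)
    (m := degStat T) (fun t ht => if_neg ht)
    (fun t ht => if_neg fun h : t = T => ht (by rw [h])) ?_ n
  have h1 : ∀ t ∈ treesFinset (degStat T),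
      (if degStat t = degStat T then (1 + X : ℝ[X]) else 1) = 1 + X :=
    fun t ht => if_pos (mem_treesFinset.1 ht)
  have h2 : ∀ t : PlaneTree, (if t = T then 1 + C (numTrees (degStat T) : ℝ) * X else 1) =
      1 + (if t = T then C (numTrees (degStat T) : ℝ) * X else 0) := fun t => by
    split_ifs <;> simp
  rw [Finset.sum_congr rfl h1]
  simp only [h2, Finset.sum_add_distrib]
  rw [Finset.sum_ite_eq', if_pos (mem_treesFinset.2 rfl),
    numTrees_eq_card]
  simp

open Polynomial in
theorem sum_choose_countStat (n : ℕ →₀ ℕ) (T : PlaneTree) (i : ℕ) :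
    ∑ t ∈ treesFinset n, ((countStat (degStat T) t).choose i : ℝ) =
      (numTrees (degStat T) : ℝ) ^ i *
        ∑ t ∈ treesFinset n, ((countTree T t).choose i : ℝ) := by
  have hcoeff : ∀ (c : ℝ) (j : ℕ), ((1 + C c * X : ℝ[X]) ^ j).coeff i = c ^ i * j.choose i := by
    intro c j
    have : (1 + C c * X : ℝ[X]) ^ j = ((1 + X : ℝ[X]) ^ j).comp (C c * X) := by simp
    rw [this, comp_C_mul_X_coeff, coeff_one_add_X_pow, mul_comm]
  have h := congrArg (fun p => p.coeff i) (sum_pow_countStat n T)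
  simpa only [finsetSum_coeff, hcoeff, coeff_one_add_X_pow, ← Finset.mul_sum] using h

theorem expect_eq_sum (n : ℕ →₀ ℕ) (f : PlaneTree → ℕ) :
    expect n f = (∑ t ∈ treesFinset n, (f t : ℝ)) / numTrees n := by
  have hprob : ∀ k : ℕ, prob n (fun t => f t = k) =
      (((treesFinset n).filter fun t => f t = k).card : ℝ) / numTrees n := by
    intro k
    rw [prob, ← Set.ncard_coe_finset]
    congr 3
    ext t
    simp [treesWith, mem_treesFinset]
  rw [expect, tsum_eq_sum (s := (treesFinset n).image f)]
  · simp only [hprob, ← mul_div_assoc]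
    rw [← Finset.sum_div, Finset.sum_comp (fun k : ℕ => (k : ℝ)) f]
    simp [mul_comm]
  · intro k hk
    rw [hprob, Finset.filter_false_of_mem]
    · simp
    · rintro t ht rfl
      exact hk (Finset.mem_image_of_mem f ht)

end PlaneTree

open PlaneTree in
/-- Lemma 3.9: mean and variance of `N_{n_T}(𝒯_n)` in terms of those of `N_T(𝒯_n)`. -/
theorem expect_variance_countStat
    (n : ℕ →₀ ℕ) (hn : IsDegStat n) (T : PlaneTree) :
    expect n (PlaneTree.countStat (PlaneTree.degStat T)) =
      (numTrees (PlaneTree.degStat T) : ℝ) * expect n (PlaneTree.countTree T) ∧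
    variance n (PlaneTree.countStat (PlaneTree.degStat T)) =
      (numTrees (PlaneTree.degStat T) : ℝ) ^ 2 *
          (variance n (PlaneTree.countTree T) - expect n (PlaneTree.countTree T)) +
        (numTrees (PlaneTree.degStat T) : ℝ) * expect n (PlaneTree.countTree T) := by
  have hN := sum_choose_countStat n T 1
  have hN2 := sum_choose_countStat n T 2
  simp only [Nat.choose_one_right, pow_one] at hN
  simp only [Nat.cast_choose_two, ← Finset.sum_div, mul_sub, mul_one, Finset.sum_sub_distrib,
    ← pow_two] at hN2
  simp only [variance, expect_eq_sum, Nat.cast_pow]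
  rw [hN] at hN2 ⊢
  have hsq : ∑ t ∈ treesFinset n, (countStat (degStat T) t : ℝ) ^ 2 =
      (numTrees (degStat T) : ℝ) ^ 2 * (∑ t ∈ treesFinset n, (countTree T t : ℝ) ^ 2 -
        ∑ t ∈ treesFinset n, (countTree T t : ℝ)) +
      (numTrees (degStat T) : ℝ) * ∑ t ∈ treesFinset n, (countTree T t : ℝ) := by
    linarith
  rw [hsq]
  constructor <;> ring
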